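/- Under the constraint system on C⁺ (dα/dv = -(η/r)(α-β), dr/dv = (1/2)(α-β) + η) with β ∈ C^∞([0,∞)), r(0) = r₀ > 0, α(0) given, and η = η(α+β) smooth positive increasing, the maximal solution exists for all v ∈ [0, ∞): none of the blowup scenarios r → 0, r → ∞, |α| → ∞ can occur in finite time. -/

import Mathlib

open Set Metric Filter Topology
open scoped NNReal

/-- The constraint vector field in the variables `(b, (a, s))`, where `s` stands for `1 / r`. -/
noncomputable def constraintField (η : ℝ → ℝ) (p : ℝ × ℝ × ℝ) : ℝ × ℝ :=
  (-(η (p.2.1 + p.1) * p.2.2) * (p.2.1 - p.1), (p.2.1 - p.1) / 2 + η (p.2.1 + p.1))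

/-- The constraint vector field with `α` truncated to `[-M, M]` and `r` truncated to `[δ, ∞)`. -/
noncomputable def truncatedField (η : ℝ → ℝ) (M δ b : ℝ) (p : ℝ × ℝ) : ℝ × ℝ :=
  constraintField η (b, max (-M) (min p.1 M), (max p.2 δ)⁻¹)

/-- The pair `(α, r)` solves the constraint system at `v`, with `r v` positive. -/
def SolvesConstraintAt (η β α r : ℝ → ℝ) (v : ℝ) : Prop :=
  0 < r v ∧
    HasDerivAt α (-(η (α v + β v) / r v) * (α v - β v)) v ∧
    HasDerivAt r ((α v - β v) / 2 + η (α v + β v)) v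

theorem truncatedField_of_mem (η : ℝ → ℝ) {M δ b a r : ℝ} (ha : |a| ≤ M) (hr : δ ≤ r) :
    truncatedField η M δ b (a, r) = (-(η (a + b) / r) * (a - b), (a - b) / 2 + η (a + b)) := by
  have h := abs_le.1 ha
  simp [truncatedField, constraintField, min_eq_left h.2, max_eq_right h.1, max_eq_left hr,
    div_eq_mul_inv]

theorem lipschitzWith_inv_max {δ : ℝ} (hδ : 0 < δ) :
    LipschitzWith (Real.toNNReal (δ⁻¹ ^ 2)) fun x : ℝ => (max x δ)⁻¹ := by
  refine LipschitzWith.of_dist_le_mul fun x y => ?_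
  have hx : δ ≤ max x δ := le_max_right _ _
  have hy : δ ≤ max y δ := le_max_right _ _
  have hx0 := hδ.trans_le hx
  have hy0 := hδ.trans_le hy
  have hxy : |max y δ - max x δ| ≤ |x - y| := by
    rw [abs_sub_comm x y]
    simpa using abs_max_sub_max_le_abs y x δ
  rw [Real.coe_toNNReal _ (by positivity), Real.dist_eq, Real.dist_eq,
    inv_sub_inv hx0.ne' hy0.ne', abs_div, abs_of_pos (mul_pos hx0 hy0), inv_pow,
    div_eq_inv_mul]
  gcongr
  nlinarith

theorem lipschitzWith_truncation {M δ : ℝ} (hδ : 0 < δ) (b : ℝ) :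
    LipschitzWith (max 0 (max 1 (Real.toNNReal (δ⁻¹ ^ 2))))
      fun p : ℝ × ℝ => ((b, max (-M) (min p.1 M), (max p.2 δ)⁻¹) : ℝ × ℝ × ℝ) := by
  refine (LipschitzWith.const b).prodMk (LipschitzWith.prodMk ?_ ?_)
  · exact (LipschitzWith.prod_fst.min_const M).const_max (-M)
  · simpa [Function.comp_def] using (lipschitzWith_inv_max hδ).comp LipschitzWith.prod_snd

theorem truncation_mem_closedBall {M δ b : ℝ} (hδ : 0 < δ) (hb : |b| ≤ M) (p : ℝ × ℝ) :
    ((b, max (-M) (min p.1 M), (max p.2 δ)⁻¹) : ℝ × ℝ × ℝ) ∈ closedBall 0 (max M δ⁻¹) := by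
  have hM : 0 ≤ M := (abs_nonneg b).trans hb
  have h : δ ≤ max p.2 δ := le_max_right _ _
  simp only [mem_closedBall, dist_zero_right, Prod.norm_def, Real.norm_eq_abs]
  refine max_le (hb.trans (le_max_left _ _)) (max_le ?_ ?_)
  · refine le_max_of_le_left (abs_le.2 ⟨le_max_left _ _, max_le (by linarith) (min_le_right _ _)⟩)
  · refine le_max_of_le_right ?_
    rw [abs_of_pos (inv_pos.2 (hδ.trans_le h))]
    exact inv_anti₀ hδ h

theorem contDiff_constraintField {η : ℝ → ℝ} (hη : ContDiff ℝ 1 η) :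
    ContDiff ℝ 1 (constraintField η) := by
  unfold constraintField
  fun_prop

theorem exists_lipschitzWith_truncatedField {η : ℝ → ℝ} (hη : ContDiff ℝ 1 η) (M : ℝ) {δ : ℝ}
    (hδ : 0 < δ) : ∃ K : ℝ≥0, ∀ b, |b| ≤ M → LipschitzWith K (truncatedField η M δ b) := by
  obtain ⟨K, hK⟩ := (contDiff_constraintField hη).contDiffOn.exists_lipschitzOnWith one_ne_zero
    (convex_closedBall (0 : ℝ × ℝ × ℝ) (max M δ⁻¹)) (isCompact_closedBall _ _)
  refine ⟨K * max 0 (max 1 (Real.toNNReal (δ⁻¹ ^ 2))), fun b hb => ?_⟩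
  rw [← lipschitzOnWith_univ]
  exact hK.comp (lipschitzWith_truncation hδ b).lipschitzOnWith
    fun p _ => truncation_mem_closedBall hδ hb p

theorem exists_norm_truncatedField_le {η : ℝ → ℝ} (hη : Continuous η) (M : ℝ) {δ : ℝ}
    (hδ : 0 < δ) : ∃ L : ℝ≥0, ∀ b, |b| ≤ M → ∀ p, ‖truncatedField η M δ b p‖ ≤ L := by
  have hc : Continuous (constraintField η) := by
    unfold constraintField
    fun_prop
  obtain ⟨L, hL⟩ := (isCompact_closedBall (0 : ℝ × ℝ × ℝ) (max M δ⁻¹)).exists_bound_of_continuousOn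
    hc.continuousOn
  refine ⟨L.toNNReal, fun b hb p => ?_⟩
  exact (hL _ (truncation_mem_closedBall hδ hb p)).trans (Real.le_coe_toNNReal L)

/-- The truncated system has solutions on arbitrarily long intervals. -/
theorem exists_solution_truncatedField {η β : ℝ → ℝ} (hη : ContDiff ℝ 1 η) (hβ : Continuous β)
    {M δ T : ℝ} (hδ : 0 < δ) (hT : 0 < T) (hM : ∀ t ∈ Icc (-1) T, |β t| ≤ M) (p₀ : ℝ × ℝ) :
    ∃ p : ℝ → ℝ × ℝ, p 0 = p₀ ∧
      ∀ t ∈ Ioo (-1) T, HasDerivAt p (truncatedField η M δ (β t) (p t)) t := by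
  obtain ⟨K, hK⟩ := exists_lipschitzWith_truncatedField hη M hδ
  obtain ⟨L, hL⟩ := exists_norm_truncatedField_le hη.continuous M hδ
  have h0 : (0 : ℝ) ∈ Icc (-1) T := ⟨by norm_num, hT.le⟩
  have hpl : IsPicardLindelof (fun t => truncatedField η M δ (β t)) ⟨0, h0⟩ p₀
      (L * Real.toNNReal (max T 1)) 0 L K := by
    refine ⟨fun t ht => (hK _ (hM t ht)).lipschitzOnWith, fun x _ => ?_,
      fun t ht x _ => hL _ (hM t ht) x, ?_⟩
    · have := hη.continuous
      unfold truncatedField constraintField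
      fun_prop
    · have : (0 : ℝ) ≤ max T 1 := le_max_of_le_right zero_le_one
      simp [this]
  obtain ⟨p, hp0, hp⟩ := hpl.exists_eq_forall_mem_Icc_hasDerivWithinAt₀
  exact ⟨p, hp0, fun t ht => (hp t (Ioo_subset_Icc_self ht)).hasDerivAt (Icc_mem_nhds ht.1 ht.2)⟩

/-- Since `α` relaxes towards `β`, it never leaves an interval containing `α 0` and all values
of `β`. -/
theorem abs_le_of_truncatedField {η β : ℝ → ℝ} (hηpos : ∀ x, 0 < η x) {M δ T : ℝ} (hδ : 0 < δ)
    (hM : ∀ t ∈ Icc 0 T, |β t| < M) {p : ℝ → ℝ × ℝ} (h0 : |(p 0).1| ≤ M)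
    (hp : ∀ t ∈ Icc 0 T, HasDerivAt p (truncatedField η M δ (β t) (p t)) t) :
    ∀ t ∈ Icc 0 T, |(p t).1| ≤ M := by
  have hd : ∀ t ∈ Icc 0 T, HasDerivAt (fun t => (p t).1)
      (truncatedField η M δ (β t) (p t)).1 t := fun t ht => (hp t ht).fst
  have hc : ContinuousOn (fun t => (p t).1) (Icc 0 T) :=
    fun t ht => (hd t ht).continuousAt.continuousWithinAt
  have hρ : ∀ t, 0 < (max (p t).2 δ)⁻¹ := fun t => inv_pos.2 (lt_max_of_lt_right hδ)
  have hup := image_le_of_deriv_right_lt_deriv_boundary' (B := fun _ => M) (B' := fun _ => 0) hc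
    (fun t ht => (hd t (Ico_subset_Icc_self ht)).hasDerivWithinAt) (abs_le.1 h0).2
    continuousOn_const (fun t _ => hasDerivWithinAt_const ..) (by
      intro t ht h
      have hb := abs_lt.1 (hM t (Ico_subset_Icc_self ht))
      have h' : max (-M) (min (p t).1 M) = M := by
        rw [h, min_self]
        exact max_eq_right (by linarith)
      simp only [truncatedField, constraintField, h']
      exact mul_neg_of_neg_of_pos (neg_neg_of_pos (mul_pos (hηpos _) (hρ t))) (by linarith))
  have hlo := image_le_of_deriv_right_lt_deriv_boundary' (f := fun _ => -M) (f' := fun _ => 0)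
    continuousOn_const (fun t _ => hasDerivWithinAt_const ..) (abs_le.1 h0).1 hc
    (fun t ht => (hd t (Ico_subset_Icc_self ht)).hasDerivWithinAt) (by
      intro t ht h
      have hb := abs_lt.1 (hM t (Ico_subset_Icc_self ht))
      have h' : max (-M) (min (p t).1 M) = -M := by
        rw [← h]
        exact max_eq_left (min_le_left _ _)
      simp only [truncatedField, constraintField, h']
      exact mul_pos_of_neg_of_neg (neg_neg_of_pos (mul_pos (hηpos _) (hρ t))) (by linarith))
  exact fun t ht => abs_le.2 ⟨hlo ht, hup ht⟩

theorem half_add_add_nonneg {m e : ℝ} (w : ℝ) (hm : 0 < m) (he : m ≤ e) :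
    0 ≤ w / 2 + e + 1 / (16 * m ^ 2) * e * w ^ 2 := by
  have h1 : 0 ≤ (e - m) * (1 + 1 / (16 * m ^ 2) * w ^ 2) :=
    mul_nonneg (by linarith) (by positivity)
  have h2 : 0 ≤ (4 * m + w) ^ 2 / (16 * m) := by positivity
  have h3 : w / 2 + e + 1 / (16 * m ^ 2) * e * w ^ 2 =
      (e - m) * (1 + 1 / (16 * m ^ 2) * w ^ 2) + (4 * m + w) ^ 2 / (16 * m) := by
    field_simp
    ring
  linarith

/-- Lower bound on `r`: the quantity `r * exp (-C / 2 * (α - β) ^ 2 + K * t)` never drops below its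
initial value. -/
theorem le_of_truncatedField {η β β' : ℝ → ℝ} (hβ : ∀ t, HasDerivAt β (β' t) t)
    {M T m C K B r₀ α₀ δ : ℝ} (hr₀ : 0 < r₀) (hm : 0 < m) (hC : C = 1 / (16 * m ^ 2))
    (hK : K = C * (2 * M * B) + 1) (hηm : ∀ x, |x| ≤ 2 * M → m ≤ η x)
    (hM : ∀ t ∈ Icc 0 T, |β t| ≤ M) (hB : ∀ t ∈ Icc 0 T, |β' t| ≤ B)
    (hδ : δ = r₀ * Real.exp (-(C / 2) * (α₀ - β 0) ^ 2 - K * T))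
    {p : ℝ → ℝ × ℝ} (h0 : p 0 = (α₀, r₀)) (hpM : ∀ t ∈ Icc 0 T, |(p t).1| ≤ M)
    (hp : ∀ t ∈ Icc 0 T, HasDerivAt p (truncatedField η M δ (β t) (p t)) t) :
    ∀ t ∈ Icc 0 T, δ ≤ (p t).2 := by
  intro s hs
  have hM0 : 0 ≤ M := (abs_nonneg _).trans (hM s hs)
  have hB0 : 0 ≤ B := (abs_nonneg _).trans (hB s hs)
  have hC0 : 0 < C := by rw [hC]; positivity
  have hK0 : 0 < K := by rw [hK]; positivity
  have hδ0 : 0 < δ := by rw [hδ]; positivity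
  set g : ℝ → ℝ := fun t => -(C / 2) * ((p t).1 - β t) ^ 2 + K * t with hg
  have hgT : ∀ t ∈ Icc 0 T, g t ≤ K * T := by
    intro t ht
    have := mul_nonneg hC0.le (sq_nonneg ((p t).1 - β t))
    have := mul_le_mul_of_nonneg_left ht.2 hK0.le
    simp only [hg]
    linarith
  have hbound : ∀ t ∈ Icc 0 T, r₀ * Real.exp (-(C / 2) * (α₀ - β 0) ^ 2) ≤
      (p t).2 * Real.exp (g t) → δ ≤ (p t).2 := by
    intro t ht h
    have h1 : δ = r₀ * Real.exp (-(C / 2) * (α₀ - β 0) ^ 2) * Real.exp (-(K * T)) := by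
      rw [hδ, sub_eq_add_neg, Real.exp_add, mul_assoc]
    have hr : 0 < (p t).2 := pos_of_mul_pos_left
      (lt_of_lt_of_le (by positivity) h) (Real.exp_pos _).le
    calc δ ≤ (p t).2 * Real.exp (g t) * Real.exp (-(K * T)) := by
          rw [h1]; gcongr
      _ = (p t).2 * Real.exp (g t - K * T) := by rw [mul_assoc, ← Real.exp_add, sub_eq_add_neg]
      _ ≤ (p t).2 * 1 := by
          gcongr
          exact Real.exp_le_one_iff.2 (by linarith [hgT t ht])
      _ = (p t).2 := mul_one _
  have hd : ∀ t ∈ Icc 0 T, HasDerivAt (fun t => (p t).2 * Real.exp (g t))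
      ((truncatedField η M δ (β t) (p t)).2 * Real.exp (g t) + (p t).2 * (Real.exp (g t) *
        (-(C / 2) * (2 * ((p t).1 - β t) * ((truncatedField η M δ (β t) (p t)).1 - β' t)) + K)))
      t := by
    intro t ht
    have h1 : HasDerivAt (fun t => (p t).1) _ t := (hp t ht).fst
    have h2 : HasDerivAt (fun t => (p t).2) _ t := (hp t ht).snd
    have h3 : HasDerivAt g _ t :=
      (((h1.sub (hβ t)).pow 2).const_mul (-(C / 2))).add ((hasDerivAt_id t).const_mul K)
    refine (h2.mul h3.exp).congr_deriv ?_
    simp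
  refine hbound s hs (image_le_of_deriv_right_lt_deriv_boundary'
    (f := fun _ => r₀ * Real.exp (-(C / 2) * (α₀ - β 0) ^ 2)) (f' := fun _ => 0)
    continuousOn_const (fun t _ => hasDerivWithinAt_const ..) (by simp [hg, h0])
    (fun t ht => (hd t ht).continuousAt.continuousWithinAt)
    (fun t ht => (hd t (Ico_subset_Icc_self ht)).hasDerivWithinAt) ?_ hs)
  intro t ht' h
  have ht := Ico_subset_Icc_self ht'
  have hδr := hbound t ht h.le
  have hr := hδ0.trans_le hδr
  rw [show p t = ((p t).1, (p t).2) from rfl, truncatedField_of_mem η (hpM t ht) hδr]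
  set w := (p t).1 - β t with hw
  set e := η ((p t).1 + β t) with he
  have ha := abs_le.1 (hpM t ht)
  have hb := abs_le.1 (hM t ht)
  have hme : m ≤ e := hηm _ (abs_le.2 ⟨by linarith, by linarith⟩)
  have hw2 : |w| ≤ 2 * M := abs_le.2 ⟨by linarith, by linarith⟩
  have hwβ : -(2 * M * B) ≤ w * β' t := by
    have : |w * β' t| ≤ 2 * M * B := by
      rw [abs_mul]
      exact mul_le_mul hw2 (hB t ht) (abs_nonneg _) (by linarith)
    exact (abs_le.1 this).1
  have hKpos : 0 < C * (w * β' t) + K := by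
    have := mul_le_mul_of_nonneg_left hwβ hC0.le
    rw [hK]
    linarith
  have hkey := half_add_add_nonneg w hm hme
  rw [← hC] at hkey
  have : (w / 2 + e) * Real.exp (g t) + (p t).2 * (Real.exp (g t) *
      (-(C / 2) * (2 * w * (-(e / (p t).2) * w - β' t)) + K)) =
      Real.exp (g t) * ((w / 2 + e + C * e * w ^ 2) + (p t).2 * (C * (w * β' t) + K)) := by
    field_simp
    ring
  rw [this]
  exact mul_pos (Real.exp_pos _) (add_pos_of_nonneg_of_pos hkey (mul_pos hr hKpos))

theorem exists_solvesConstraintAt_Icc {η β : ℝ → ℝ} {r₀ : ℝ} (hr₀ : 0 < r₀) (α₀ : ℝ)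
    (hη : ContDiff ℝ 1 η) (hηpos : ∀ x, 0 < η x) (hηmono : Monotone η) (hβ : ContDiff ℝ 1 β)
    {T : ℝ} (hT : 0 ≤ T) :
    ∃ α r : ℝ → ℝ, α 0 = α₀ ∧ r 0 = r₀ ∧ ∀ v ∈ Icc 0 T, SolvesConstraintAt η β α r v := by
  obtain ⟨M₁, hM₁⟩ := (isCompact_Icc (a := (-1 : ℝ)) (b := T + 1)).exists_bound_of_continuousOn
    hβ.continuous.continuousOn
  obtain ⟨B, hB⟩ := (isCompact_Icc (a := (0 : ℝ)) (b := T)).exists_bound_of_continuousOn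
    (hβ.continuous_deriv le_rfl).continuousOn
  set M := max M₁ |α₀| + 1 with hMdef
  have hβM : ∀ t ∈ Icc (-1) (T + 1), |β t| < M := fun t ht =>
    lt_of_le_of_lt ((hM₁ t ht).trans (le_max_left _ _)) (lt_add_one _)
  have hαM : |α₀| ≤ M := (le_max_right _ _).trans (lt_add_one _).le
  have hsub : ∀ t ∈ Icc 0 T, t ∈ Ioo (-1) (T + 1) := fun t ht =>
    ⟨by linarith [ht.1], by linarith [ht.2]⟩
  have hβM' : ∀ t ∈ Icc 0 T, |β t| < M := fun t ht => hβM t (Ioo_subset_Icc_self (hsub t ht))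
  set C := 1 / (16 * η (-(2 * M)) ^ 2) with hC
  set K := C * (2 * M * B) + 1 with hK
  set δ := r₀ * Real.exp (-(C / 2) * (α₀ - β 0) ^ 2 - K * T) with hδ
  have hδ0 : 0 < δ := by positivity
  obtain ⟨p, hp0, hp⟩ := exists_solution_truncatedField hη hβ.continuous hδ0
    (by linarith : 0 < T + 1) (fun t ht => (hβM t ht).le) (α₀, r₀)
  have hp' : ∀ t ∈ Icc 0 T, HasDerivAt p (truncatedField η M δ (β t) (p t)) t :=
    fun t ht => hp t (hsub t ht)
  have hpM := abs_le_of_truncatedField hηpos hδ0 hβM' (by simpa [hp0] using hαM) hp'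
  have hpδ := le_of_truncatedField
    (fun t => (hβ.differentiable one_ne_zero t).hasDerivAt) hr₀ (hηpos _) hC hK
    (fun x hx => hηmono (abs_le.1 hx).1) (fun t ht => (hβM' t ht).le) hB hδ hp0 hpM hp'
  refine ⟨fun t => (p t).1, fun t => (p t).2, by simp [hp0], by simp [hp0], fun v hv => ?_⟩
  have h := hp' v hv
  rw [show p v = ((p v).1, (p v).2) from rfl,
    truncatedField_of_mem η (hpM v hv) (hpδ v hv)] at h
  exact ⟨hδ0.trans_le (hpδ v hv), h.fst, h.snd⟩

theorem SolvesConstraintAt.eqOn_Icc {η β α₁ r₁ α₂ r₂ : ℝ → ℝ} (hη : ContDiff ℝ 1 η)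
    (hβ : Continuous β) {T : ℝ} (h₁ : ∀ v ∈ Icc 0 T, SolvesConstraintAt η β α₁ r₁ v)
    (h₂ : ∀ v ∈ Icc 0 T, SolvesConstraintAt η β α₂ r₂ v) (hα : α₁ 0 = α₂ 0) (hr : r₁ 0 = r₂ 0) :
    EqOn (fun v => (α₁ v, r₁ v)) (fun v => (α₂ v, r₂ v)) (Icc 0 T) := by
  have key : ∀ α r : ℝ → ℝ, (∀ v ∈ Icc 0 T, SolvesConstraintAt η β α r v) →
      ∃ M δ : ℝ, 0 < δ ∧ ∀ v ∈ Icc 0 T, |α v| ≤ M ∧ δ ≤ r v := by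
    intro α r h
    have hcα : ContinuousOn α (Icc 0 T) := fun v hv =>
      (h v hv).2.1.continuousAt.continuousWithinAt
    have hcr : ContinuousOn r (Icc 0 T) := fun v hv =>
      (h v hv).2.2.continuousAt.continuousWithinAt
    obtain ⟨M, hM⟩ := isCompact_Icc.exists_bound_of_continuousOn hcα
    obtain ⟨δ, hδ, hδr⟩ := isCompact_Icc.exists_forall_le' hcr (a := 0) fun v hv => (h v hv).1
    exact ⟨M, δ, hδ, fun v hv => ⟨hM v hv, hδr v hv⟩⟩
  obtain ⟨M₁, δ₁, hδ₁, hb₁⟩ := key α₁ r₁ h₁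
  obtain ⟨M₂, δ₂, hδ₂, hb₂⟩ := key α₂ r₂ h₂
  obtain ⟨M₃, hb₃⟩ := (isCompact_Icc (a := (0 : ℝ)) (b := T)).exists_bound_of_continuousOn
    hβ.continuousOn
  set M := max M₁ (max M₂ M₃)
  set δ := min δ₁ δ₂
  have deriv_eq : ∀ α r : ℝ → ℝ, ∀ v, SolvesConstraintAt η β α r v → |α v| ≤ M → δ ≤ r v →
      HasDerivAt (fun v => (α v, r v)) (truncatedField η M δ (β v) (α v, r v)) v := by
    intro α r v h hM hδ
    rw [truncatedField_of_mem η hM hδ]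
    exact h.2.1.prodMk h.2.2
  have hd₁ : ∀ v ∈ Icc 0 T, HasDerivAt (fun v => (α₁ v, r₁ v))
      (truncatedField η M δ (β v) (α₁ v, r₁ v)) v := fun v hv =>
    deriv_eq _ _ v (h₁ v hv) ((hb₁ v hv).1.trans (le_max_left _ _))
      ((min_le_left _ _).trans (hb₁ v hv).2)
  have hd₂ : ∀ v ∈ Icc 0 T, HasDerivAt (fun v => (α₂ v, r₂ v))
      (truncatedField η M δ (β v) (α₂ v, r₂ v)) v := fun v hv =>
    deriv_eq _ _ v (h₂ v hv)
      ((hb₂ v hv).1.trans ((le_max_left _ _).trans (le_max_right _ _)))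
      ((min_le_right _ _).trans (hb₂ v hv).2)
  obtain ⟨K, hK⟩ := exists_lipschitzWith_truncatedField hη M (lt_min hδ₁ hδ₂ : 0 < δ)
  refine ODE_solution_unique_of_mem_Icc_right (s := fun _ => univ) (K := K)
    (v := fun t => truncatedField η M δ (β t)) (fun t ht => ?_)
    (fun v hv => (hd₁ v hv).continuousAt.continuousWithinAt)
    (fun t ht => (hd₁ t (Ico_subset_Icc_self ht)).hasDerivWithinAt) (fun _ _ => mem_univ _)
    (fun v hv => (hd₂ v hv).continuousAt.continuousWithinAt)
    (fun t ht => (hd₂ t (Ico_subset_Icc_self ht)).hasDerivWithinAt) (fun _ _ => mem_univ _)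
    (by simp [hα, hr])
  exact (hK _ ((hb₃ t (Ico_subset_Icc_self ht)).trans
    ((le_max_right _ _).trans (le_max_right _ _)))).lipschitzOnWith

theorem SolvesConstraintAt.congr {η β α₁ r₁ α₂ r₂ : ℝ → ℝ} {v : ℝ}
    (h : SolvesConstraintAt η β α₁ r₁ v) (hα : α₂ =ᶠ[𝓝 v] α₁) (hr : r₂ =ᶠ[𝓝 v] r₁) :
    SolvesConstraintAt η β α₂ r₂ v := by
  refine ⟨?_, ?_, ?_⟩ <;> simp only [hα.eq_of_nhds, hr.eq_of_nhds]
  exacts [h.1, h.2.1.congr_of_eventuallyEq hα, h.2.2.congr_of_eventuallyEq hr]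


/-- global existence of the derived data along C⁺. With β smooth on the
half-line, η = η(α+β) smooth, positive and strictly increasing, r(0) = r₀ > 0 and
α(0) = α₀ given, the constraint system dα/dv = -(η/r)(α-β),
dr/dv = (α-β)/2 + η admits a solution for all v ≥ 0 (with r staying positive):
none of the blowup scenarios r → 0, r → ∞, |α| → ∞ occurs in finite time. -/
theorem stmt7 (r₀ α₀ : ℝ) (hr₀ : 0 < r₀)
    (η : ℝ → ℝ) (hηs : ContDiff ℝ (⊤ : ℕ∞) η) (hηpos : ∀ x : ℝ, 0 < η x)
    (hηmono : StrictMono η)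
    (β : ℝ → ℝ) (hβ : ContDiff ℝ (⊤ : ℕ∞) β) :
    ∃ α r : ℝ → ℝ, α 0 = α₀ ∧ r 0 = r₀ ∧
      ∀ v ∈ Set.Ici (0:ℝ),
        0 < r v ∧
        HasDerivAt α (-(η (α v + β v) / r v) * (α v - β v)) v ∧
        HasDerivAt r ((α v - β v) / 2 + η (α v + β v)) v := by
  have hη : ContDiff ℝ 1 η := hηs.of_le (by exact_mod_cast le_top)
  have hβ₁ : ContDiff ℝ 1 β := hβ.of_le (by exact_mod_cast le_top)
  have hex : ∀ n : ℕ, ∃ α r : ℝ → ℝ, α 0 = α₀ ∧ r 0 = r₀ ∧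
      ∀ v ∈ Icc (0 : ℝ) (n + 1), SolvesConstraintAt η β α r v := fun n =>
    exists_solvesConstraintAt_Icc hr₀ α₀ hη hηpos hηmono.monotone hβ₁ (by positivity)
  choose α r hα hr hsol using hex
  have heq : ∀ m n : ℕ, m ≤ n → ∀ v ∈ Icc (0 : ℝ) (m + 1), α m v = α n v ∧ r m v = r n v := by
    intro m n hmn v hv
    have hmn' : (m : ℝ) ≤ n := by exact_mod_cast hmn
    have := SolvesConstraintAt.eqOn_Icc hη hβ₁.continuous (hsol m)
      (fun v hv => hsol n v ⟨hv.1, by linarith [hv.2]⟩) (by rw [hα, hα]) (by rw [hr, hr]) hv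
    exact Prod.mk.inj this
  refine ⟨fun t => α ⌈t⌉₊ t, fun t => r ⌈t⌉₊ t, by simp [hα], by simp [hr], fun v hv => ?_⟩
  have hv0 : (0 : ℝ) ≤ v := hv
  have hglue : ∀ᶠ t in 𝓝 v, α ⌈t⌉₊ t = α ⌈v⌉₊ t ∧ r ⌈t⌉₊ t = r ⌈v⌉₊ t := by
    have hvc : v < (⌈v⌉₊ : ℝ) + 1 := by linarith [Nat.le_ceil v]
    rcases hv0.eq_or_lt with rfl | hpos
    · filter_upwards [Iio_mem_nhds hvc] with t ht
      rcases le_total t 0 with h | h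
      · simp [Nat.ceil_eq_zero.2 h]
      · have := heq 0 ⌈t⌉₊ (Nat.zero_le _) t ⟨h, by simpa using (mem_Iio.1 ht).le⟩
        simpa using ⟨this.1.symm, this.2.symm⟩
    · filter_upwards [Iio_mem_nhds hvc, Ioi_mem_nhds hpos] with t ht ht0
      rcases le_total ⌈t⌉₊ ⌈v⌉₊ with h | h
      · exact heq _ _ h t ⟨(mem_Ioi.1 ht0).le, by linarith [Nat.le_ceil t]⟩
      · have := heq _ _ h t ⟨(mem_Ioi.1 ht0).le, (mem_Iio.1 ht).le⟩
        exact ⟨this.1.symm, this.2.symm⟩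
  exact (hsol ⌈v⌉₊ v ⟨hv0, by linarith [Nat.le_ceil v]⟩).congr
    (hglue.mono fun _ h => h.1) (hglue.mono fun _ h => h.2)
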